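/- Let I be an open interval and f : I → ℝ continuous, strictly monotone, with A_f Jensen convex and A_f not equal to the arithmetic mean. Then (with f ∈ C², f′ ≠ 0 guaranteed) f″ is nowhere vanishing; in particular A_f(x,y) > (x+y)/2 for some x, y ∈ I, and f″/f′ > 0 everywhere on I after replacing f by −f if necessary. -/

import Mathlib

/-- The `n`-variable quasiarithmetic mean on `I` generated by `f`. -/
noncomputable def QAMean (I : Set ℝ) (f : ℝ → ℝ) {n : ℕ} (a : Fin n → ℝ) : ℝ :=
  Function.invFunOn f I ((∑ i, f (a i)) / n)

open Set Filter Topology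

theorem aux_convexOn_of_midpoint {T : Set ℝ} {φ : ℝ → ℝ} (hT : Convex ℝ T) (hc : ContinuousOn φ T)
    (hm : ∀ x ∈ T, ∀ y ∈ T, φ ((x + y) / 2) ≤ (φ x + φ y) / 2) : ConvexOn ℝ T φ := by
  refine LinearOrder.convexOn_of_lt hT ?_
  intro x hx y hy hxy a b ha hb hab
  by_contra hcon
  push Not at hcon
  have hsub : Icc x y ⊆ T := hT.ordConnected.out hx hy
  set κ : ℝ := (φ y - φ x) / (y - x) with hκ
  have hκ' : κ * (y - x) = φ y - φ x := by
    rw [hκ]; field_simp [sub_ne_zero.2 hxy.ne']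
  set ψ : ℝ → ℝ := fun t => φ t - (φ x + κ * (t - x)) with hψ
  have hψc : ContinuousOn ψ (Icc x y) := by
    refine (hc.mono hsub).sub ?_
    fun_prop
  set z := a • x + b • y with hz
  have hz1 : z ∈ Icc x y := by
    simp only [hz, smul_eq_mul]
    have : a = 1 - b := by linarith
    subst this
    constructor <;> nlinarith
  have hz2 : 0 < ψ z := by
    simp only [smul_eq_mul] at hcon
    have h1 : z - x = b * (y - x) := by
      simp only [hz, smul_eq_mul]
      have : a = 1 - b := by linarith
      subst this; ring
    have h2 : a = 1 - b := by linarith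
    have h3 : κ * (z - x) = b * (φ y - φ x) := by rw [h1, ← hκ']; ring
    simp only [hψ, h3]
    rw [h2] at hcon
    linarith
  obtain ⟨c0, hc0, hmax⟩ := isCompact_Icc.exists_isMaxOn ⟨z, hz1⟩ hψc
  have hKc : IsCompact (Icc x y ∩ ψ ⁻¹' {ψ c0}) :=
    isCompact_Icc.of_isClosed_subset (hψc.preimage_isClosed_of_isClosed isClosed_Icc isClosed_singleton)
      inter_subset_left
  obtain ⟨c, ⟨hcI, hcv⟩, hcl⟩ := hKc.exists_isLeast ⟨c0, hc0, rfl⟩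
  have hcv : ψ c = ψ c0 := hcv
  have hpos : 0 < ψ c0 := lt_of_lt_of_le hz2 (hmax hz1)
  have hψx : ψ x = 0 := by simp [hψ]
  have hψy : ψ y = 0 := by simp only [hψ, hκ']; ring
  have hxc : x < c := lt_of_le_of_ne hcI.1 (by rintro rfl; linarith)
  have hcy : c < y := lt_of_le_of_ne hcI.2 (by rintro rfl; linarith)
  obtain ⟨δ, hδ, hδ1, hδ2⟩ : ∃ δ > 0, x ≤ c - δ ∧ c + δ ≤ y :=
    ⟨min (c - x) (y - c), lt_min (by linarith) (by linarith),
      by linarith [min_le_left (c - x) (y - c)], by linarith [min_le_right (c - x) (y - c)]⟩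
  have m1 : c - δ ∈ Icc x y := ⟨hδ1, by linarith⟩
  have m2 : c + δ ∈ Icc x y := ⟨by linarith, hδ2⟩
  have k1 : ψ (c - δ) < ψ c0 := by
    refine lt_of_le_of_ne (hmax m1) fun h => ?_
    have := hcl ⟨m1, h⟩
    linarith
  have k2 : ψ (c + δ) ≤ ψ c0 := hmax m2
  have k3 := hm _ (hsub m1) _ (hsub m2)
  rw [show (c - δ + (c + δ)) / 2 = c by ring] at k3
  have k4 : φ c - (φ x + κ * (c - x)) = ψ c0 := hcv
  have k5 : φ (c - δ) - (φ x + κ * (c - δ - x)) < ψ c0 := k1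
  have k6 : φ (c + δ) - (φ x + κ * (c + δ - x)) ≤ ψ c0 := k2
  nlinarith

theorem aux_dense_diff {I U : Set ℝ} {f : ℝ → ℝ} (hf : MonotoneOn f I) (hU : IsOpen U)
    (hUI : U ⊆ I) (hne : U.Nonempty) : ∃ x ∈ U, DifferentiableAt ℝ f x := by
  have h := (hf.mono hUI).ae_differentiableWithinAt_of_mem
  by_contra hcon
  push Not at hcon
  have h0 : MeasureTheory.volume U = 0 := by
    refine MeasureTheory.measure_mono_null ?_ h
    intro x hx h'
    exact hcon x hx ((h' hx).differentiableAt (hU.mem_nhds hx))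
  exact (hU.measure_pos MeasureTheory.volume hne).ne' h0

theorem aux_deriv_cont {I : Set ℝ} {f h : ℝ → ℝ} (hI : IsOpen I) (hm : MonotoneOn h I)
    (hd : ∀ x ∈ I, HasDerivAt f (h x) x) : ContinuousOn h I := by
  intro x hx
  refine ContinuousAt.continuousWithinAt ?_
  obtain ⟨r, hr, hball⟩ := Metric.isOpen_iff.1 hI x hx
  have hsub : Icc (x - r/2) (x + r/2) ⊆ I := by
    intro y hy
    apply hball
    rw [Metric.mem_ball, Real.dist_eq, abs_lt]
    constructor <;> linarith [hy.1, hy.2]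
  refine tendsto_order.2 ⟨fun c hcx => ?_, fun c hcx => ?_⟩
  · obtain ⟨b, hb1, hb2, hb3⟩ : ∃ b, x - r/2 ≤ b ∧ b < x ∧ c < h b := by
      by_cases hh : c < h (x - r/2)
      · exact ⟨_, le_rfl, by linarith, hh⟩
      · push Not at hh
        obtain ⟨b, hb, hbe⟩ := exists_hasDerivWithinAt_eq_of_gt_of_lt (a := x - r/2) (b := x)
          (f := f) (f' := h) (m := (c + h x) / 2) (by linarith)
          (fun y hy => (hd y (hsub ⟨hy.1, by linarith [hy.2]⟩)).hasDerivWithinAt)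
          (by linarith) (by linarith)
        exact ⟨b, hb.1.le, hb.2, by rw [hbe]; linarith⟩
    filter_upwards [Ioo_mem_nhds hb2 (show x < x + r/2 by linarith)] with y hy
    exact hb3.trans_le (hm (hsub ⟨hb1, by linarith⟩) (hsub ⟨by linarith [hy.1], hy.2.le⟩) hy.1.le)
  · obtain ⟨b, hb1, hb2, hb3⟩ : ∃ b, b ≤ x + r/2 ∧ x < b ∧ h b < c := by
      by_cases hh : h (x + r/2) < c
      · exact ⟨_, le_rfl, by linarith, hh⟩
      · push Not at hh
        obtain ⟨b, hb, hbe⟩ := exists_hasDerivWithinAt_eq_of_gt_of_lt (a := x) (b := x + r/2)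
          (f := f) (f' := h) (m := (c + h x) / 2) (by linarith)
          (fun y hy => (hd y (hsub ⟨by linarith [hy.1], hy.2⟩)).hasDerivWithinAt)
          (by linarith) (by linarith)
        exact ⟨b, hb.2.le, hb.1, by rw [hbe]; linarith⟩
    filter_upwards [Ioo_mem_nhds (show x - r/2 < x by linarith) hb2] with y hy
    exact (hm (hsub ⟨hy.1.le, by linarith [hy.2]⟩) (hsub ⟨by linarith, hb1⟩) hy.2.le).trans_lt hb3

theorem aux_dini_le {h D : ℝ → ℝ} {a b C : ℝ} (hc : ContinuousOn h (Icc a b)) (hab : a ≤ b)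
    (hu : ∀ x ∈ Icc a b, ∀ c, D x < c → ∃ᶠ t in 𝓝[>] x, h t - h x < c * (t - x))
    (hD : ∀ x ∈ Icc a b, D x < C) : h b - h a ≤ C * (b - a) := by
  have := image_le_of_liminf_slope_right_lt_deriv_boundary' (f := h) (f' := D) hc
    (fun x hx r hr => ((hu x ⟨hx.1, hx.2.le⟩ r hr).and_eventually self_mem_nhdsWithin).mono (by
      rintro t ⟨ht, htx⟩
      have htx : x < t := htx
      rw [slope_def_field, div_lt_iff₀ (by linarith)]
      exact ht))
    (B := fun t => h a + C * (t - a)) (B' := fun _ => C) (by simp) (by fun_prop)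
    (fun x hx => by
      have : HasDerivAt (fun t => h a + C * (t - a)) C x := by
        simpa using (((hasDerivAt_id x).sub_const a).const_mul C).const_add (h a)
      exact this.hasDerivWithinAt)
    (fun x hx _ => hD x ⟨hx.1, hx.2.le⟩) (right_mem_Icc.2 hab)
  linarith

theorem aux_dini {I : Set ℝ} {h D : ℝ → ℝ} (hI : IsOpen I) (hc : ContinuousOn h I)
    (hDc : ContinuousOn D I)
    (hu : ∀ x ∈ I, ∀ c, D x < c → ∀ᶠ t in 𝓝[>] x, h t - h x < c * (t - x))
    (hl : ∀ x ∈ I, ∀ c, c < D x → ∃ᶠ t in 𝓝[>] x, c * (t - x) < h t - h x) :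
    ∀ x ∈ I, HasDerivAt h (D x) x := by
  intro x hx
  rw [hasDerivAt_iff_isLittleO, Asymptotics.isLittleO_iff]
  intro ε hε
  have hDx := hDc.continuousAt (hI.mem_nhds hx)
  have h1 : ∀ᶠ y in 𝓝 x, y ∈ I ∧ D x - ε < D y ∧ D y < D x + ε :=
    Filter.Eventually.and (hI.eventually_mem hx) ((hDx.eventually_const_lt (by linarith)).and
      (hDx.eventually_lt_const (by linarith)))
  obtain ⟨r, hr, hball⟩ := Metric.eventually_nhds_iff_ball.1 h1
  have key : ∀ a ∈ Metric.ball x r, ∀ b ∈ Metric.ball x r, a ≤ b →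
      h b - h a ≤ (D x + ε) * (b - a) ∧ (D x - ε) * (b - a) ≤ h b - h a := by
    intro a ha b hb hab
    have hsub : Icc a b ⊆ Metric.ball x r := (convex_ball x r).ordConnected.out ha hb
    have hcc : ContinuousOn h (Icc a b) := hc.mono fun y hy => (hball y (hsub hy)).1
    constructor
    · exact aux_dini_le hcc hab (D := D) (fun y hy c hcy =>
        (hu y (hball y (hsub hy)).1 c hcy).frequently) (fun y hy => (hball y (hsub hy)).2.2)
    · have := aux_dini_le (h := fun t => - h t) (D := fun t => - D t) (C := -(D x - ε)) hcc.neg hab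
        (fun y hy c hcy => (hl y (hball y (hsub hy)).1 (-c) (by linarith)).mono (by
          intro t ht; linarith)) (fun y hy => by linarith [(hball y (hsub hy)).2.1])
      linarith
  filter_upwards [Metric.ball_mem_nhds x hr] with y hy
  rw [Real.norm_eq_abs, Real.norm_eq_abs, smul_eq_mul]
  have hxr : x ∈ Metric.ball x r := Metric.mem_ball_self hr
  rcases le_total x y with hxy | hxy
  · obtain ⟨k1, k2⟩ := key x hxr y hy hxy
    rw [abs_of_nonneg (sub_nonneg.2 hxy), abs_le]
    constructor <;> nlinarith
  · obtain ⟨k1, k2⟩ := key y hy x hxr hxy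
    rw [abs_of_nonpos (sub_nonpos.2 hxy), abs_le]
    constructor <;> nlinarith

theorem aux_midpoint_cont {J : Set ℝ} {φ : ℝ → ℝ} (hJ : IsOpen J) 
    (hm : ∀ x ∈ J, ∀ y ∈ J, φ ((x + y) / 2) ≤ (φ x + φ y) / 2)
    (hb : ∀ x ∈ J, ∃ B, ∀ᶠ y in 𝓝 x, φ y ≤ B) : ContinuousOn φ J := by
  intro x hx
  refine ContinuousAt.continuousWithinAt ?_
  obtain ⟨B, hB⟩ := hb x hx
  obtain ⟨r, hr, hball⟩ := Metric.eventually_nhds_iff_ball.1 (hB.and (hJ.mem_nhds hx))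
  have hxr : x ∈ J := hx
  have hmem : ∀ u, |u| < r → φ (x + u) ≤ B ∧ x + u ∈ J := fun u hu =>
    hball _ (by simpa [Real.dist_eq] using hu)
  have key : ∀ n : ℕ, ∀ u, |2 ^ n * u| < r → φ (x + u) - φ x ≤ (B - φ x) / 2 ^ n := by
    intro n
    induction n with
    | zero => intro u hu; simp at hu ⊢; exact (hmem u hu).1
    | succ n ih =>
      intro u hu
      have h2 : |2 ^ n * (2 * u)| < r := by convert hu using 2; ring
      have i1 := ih (2 * u) h2
      have h3 : |2 * u| < r := by
        refine lt_of_le_of_lt ?_ h2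
        rw [abs_mul (2 ^ n), abs_of_pos (by positivity : (0:ℝ) < 2 ^ n)]
        exact le_mul_of_one_le_left (abs_nonneg _) (one_le_pow₀ (by norm_num))
      have i2 := hm x hx _ (hmem _ h3).2
      rw [show (x + (x + 2 * u)) / 2 = x + u by ring] at i2
      have : (B - φ x) / 2 ^ (n + 1) = ((B - φ x) / 2 ^ n) / 2 := by rw [pow_succ]; field_simp
      rw [this]; linarith
  rw [Metric.continuousAt_iff']
  intro ε hε
  have hBx : φ x ≤ B := by simpa using (hmem 0 (by simpa using hr)).1
  obtain ⟨n, hn⟩ : ∃ n : ℕ, (B - φ x) / 2 ^ n < ε := by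
    obtain ⟨n, hn⟩ := pow_unbounded_of_one_lt ((B - φ x) / ε) (by norm_num : (1:ℝ) < 2)
    refine ⟨n, ?_⟩
    rw [div_lt_iff₀ hε] at hn
    rw [div_lt_iff₀ (by positivity)]; linarith
  have hδ : 0 < r / 2 ^ n := by positivity
  filter_upwards [Metric.ball_mem_nhds x hδ] with y hy
  rw [Metric.mem_ball, Real.dist_eq, lt_div_iff₀ (by positivity)] at hy
  have e1 : |2 ^ n * (y - x)| < r := by
    rw [abs_mul, abs_of_pos (by positivity : (0:ℝ) < 2 ^ n), mul_comm]; exact hy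
  have e2 : |2 ^ n * (-(y - x))| < r := by rw [mul_neg, abs_neg]; exact e1
  have k1 := key n _ e1
  have k2 := key n _ e2
  have small : ∀ u, |2 ^ n * u| < r → |u| < r := by
    intro u hu
    refine lt_of_le_of_lt ?_ hu
    rw [abs_mul (2 ^ n), abs_of_pos (by positivity : (0:ℝ) < 2 ^ n)]
    exact le_mul_of_one_le_left (abs_nonneg _) (one_le_pow₀ (by norm_num))
  have k3 := hm _ (hmem _ (small _ e1)).2 _ (hmem _ (small _ e2)).2
  rw [show (x + (y - x) + (x + -(y - x))) / 2 = x by ring] at k3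
  rw [show x + (y - x) = y by ring] at k1 k3
  rw [Real.dist_eq, abs_lt]
  constructor <;> linarith

structure QCore (I : Set ℝ) (f g : ℝ → ℝ) : Prop where
  op : IsOpen I
  cv : Convex ℝ I
  fc : ContinuousOn f I
  mono : StrictMonoOn f I
  inv : ∀ x ∈ I, g (f x) = x
  conv : ∀ x ∈ I, ∀ y ∈ I, ∀ u ∈ I, ∀ v ∈ I,
    g ((f ((x + y) / 2) + f ((u + v) / 2)) / 2) ≤ (g ((f x + f u) / 2) + g ((f y + f v) / 2)) / 2

namespace QCore
variable {I : Set ℝ} {f g : ℝ → ℝ}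

theorem exists_pm (H : QCore I f g) {x : ℝ} (hx : x ∈ I) {ε : ℝ} (hε : 0 < ε) :
    ∃ δ > 0, δ < ε ∧ x - δ ∈ I ∧ x + δ ∈ I := by
  obtain ⟨r, hr, hball⟩ := Metric.isOpen_iff.1 H.op x hx
  refine ⟨min r ε / 2, by positivity, by linarith [min_le_right r ε], ?_, ?_⟩ <;>
  · apply hball
    rw [Metric.mem_ball, Real.dist_eq, abs_lt]
    have := min_le_left r ε
    have : 0 < min r ε := by positivity
    constructor <;> linarith

theorem jopen (H : QCore I f g) : IsOpen (f '' I) := by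
  rw [isOpen_iff_mem_nhds]
  rintro _ ⟨x, hx, rfl⟩
  obtain ⟨δ, hδ, -, h1, h2⟩ := H.exists_pm hx one_pos
  have hsub : Icc (x - δ) (x + δ) ⊆ I := H.cv.ordConnected.out h1 h2
  refine mem_of_superset (Icc_mem_nhds (H.mono h1 hx (by linarith)) (H.mono hx h2 (by linarith))) ?_
  exact (intermediate_value_Icc (by linarith) (H.fc.mono hsub)).trans (image_mono hsub)

theorem jconv (H : QCore I f g) : Convex ℝ (f '' I) :=
  (H.cv.isPreconnected.image f H.fc).ordConnected.convex

theorem jmid (H : QCore I f g) {s t : ℝ} (hs : s ∈ f '' I) (ht : t ∈ f '' I) :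
    (s + t) / 2 ∈ f '' I := by
  have := H.jconv hs ht (a := 1/2) (b := 1/2) (by norm_num) (by norm_num) (by norm_num)
  convert this using 1
  simp; ring

theorem gmem (H : QCore I f g) {s : ℝ} (hs : s ∈ f '' I) : g s ∈ I := by
  obtain ⟨x, hx, rfl⟩ := hs
  rwa [H.inv x hx]

theorem fg (H : QCore I f g) {s : ℝ} (hs : s ∈ f '' I) : f (g s) = s := by
  obtain ⟨x, hx, rfl⟩ := hs
  rw [H.inv x hx]

theorem gcont (H : QCore I f g) {s : ℝ} (hs : s ∈ f '' I) : ContinuousAt g s := by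
  obtain ⟨x, hx, rfl⟩ := hs
  rw [Metric.continuousAt_iff']
  intro ε hε
  obtain ⟨δ, hδ, hδε, h1, h2⟩ := H.exists_pm hx hε
  filter_upwards [Ioo_mem_nhds (H.mono h1 hx (by linarith)) (H.mono hx h2 (by linarith)),
    H.jopen.mem_nhds ⟨x, hx, rfl⟩] with t ht htJ
  rw [H.inv x hx, Real.dist_eq, abs_lt]
  rw [← H.fg htJ] at ht
  have a1 := (H.mono.lt_iff_lt h1 (H.gmem htJ)).1 ht.1
  have a2 := (H.mono.lt_iff_lt (H.gmem htJ) h2).1 ht.2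
  constructor <;> linarith

theorem mid_le (H : QCore I f g) {x y : ℝ} (hx : x ∈ I) (hy : y ∈ I) :
    (x + y) / 2 ≤ g ((f x + f y) / 2) := by
  have hm : (x + y) / 2 ∈ I := by
    have := H.cv hx hy (a := 1/2) (b := 1/2) (by norm_num) (by norm_num) (by norm_num)
    convert this using 1
    simp; ring
  have := H.conv x hx y hy y hy x hx
  rw [show (y + x) / 2 = (x + y) / 2 by ring, add_self_div_two, H.inv _ hm, add_comm (f y) (f x),
    add_self_div_two] at this
  exact this

theorem fconv (H : QCore I f g) : ConvexOn ℝ I f := by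
  refine aux_convexOn_of_midpoint H.cv H.fc fun x hx y hy => ?_
  have hm : (x + y) / 2 ∈ I := by
    have := H.cv hx hy (a := 1/2) (b := 1/2) (by norm_num) (by norm_num) (by norm_num)
    convert this using 1
    simp; ring
  have hJ := H.jmid ⟨x, hx, rfl⟩ ⟨y, hy, rfl⟩
  have := (H.mono.le_iff_le hm (H.gmem hJ)).2 (H.mid_le hx hy)
  rwa [H.fg hJ] at this

/-- the curve -/
noncomputable def cur (f g : ℝ → ℝ) (x y p q t : ℝ) : ℝ := g ((f (x + t * p) + f (y + t * q)) / 2)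

def dom (I : Set ℝ) (x y p q : ℝ) : Set ℝ := {t | x + t * p ∈ I ∧ y + t * q ∈ I}

theorem dom_open (H : QCore I f g) (x y p q : ℝ) : IsOpen (dom I x y p q) :=
  (H.op.preimage (by fun_prop : Continuous fun t : ℝ => x + t * p)).inter
    (H.op.preimage (by fun_prop : Continuous fun t : ℝ => y + t * q))

theorem dom_conv (H : QCore I f g) (x y p q : ℝ) : Convex ℝ (dom I x y p q) := by
  intro s hs t ht a b ha hb hab
  have hb' : b = 1 - a := by linarith
  constructor
  · convert H.cv hs.1 ht.1 ha hb hab using 1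
    simp only [smul_eq_mul, hb']; ring
  · convert H.cv hs.2 ht.2 ha hb hab using 1
    simp only [smul_eq_mul, hb']; ring

theorem cur_J (H : QCore I f g) {x y p q t : ℝ} (ht : t ∈ dom I x y p q) :
    (f (x + t * p) + f (y + t * q)) / 2 ∈ f '' I :=
  H.jmid ⟨_, ht.1, rfl⟩ ⟨_, ht.2, rfl⟩

theorem cur_cont (H : QCore I f g) (x y p q : ℝ) :
    ContinuousOn (cur f g x y p q) (dom I x y p q) := by
  intro t ht
  refine ContinuousAt.continuousWithinAt ?_
  refine ContinuousAt.comp (g := g) (f := fun t => (f (x + t * p) + f (y + t * q)) / 2)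
    (H.gcont (H.cur_J ht)) ?_
  have h1 : ContinuousAt f (x + t * p) := H.fc.continuousAt (H.op.mem_nhds ht.1)
  have h2 : ContinuousAt f (y + t * q) := H.fc.continuousAt (H.op.mem_nhds ht.2)
  have h1' : ContinuousAt (fun t => f (x + t * p)) t :=
    ContinuousAt.comp (g := f) (f := fun t => x + t * p) h1 (by fun_prop)
  have h2' : ContinuousAt (fun t => f (y + t * q)) t :=
    ContinuousAt.comp (g := f) (f := fun t => y + t * q) h2 (by fun_prop)
  exact (h1'.add h2').div_const 2

theorem cur_conv (H : QCore I f g) (x y p q : ℝ) :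
    ConvexOn ℝ (dom I x y p q) (cur f g x y p q) := by
  refine aux_convexOn_of_midpoint (H.dom_conv x y p q) (H.cur_cont x y p q) ?_
  intro s hs t ht
  have := H.conv _ hs.1 _ ht.1 _ hs.2 _ ht.2
  unfold cur
  convert this using 5 <;> ring_nf

theorem slope_pos (H : QCore I f g) {x y : ℝ} (hx : x ∈ I) (hy : y ∈ I) (hxy : x < y) :
    0 < slope f x y := by
  rw [slope_def_field]
  exact div_pos (by linarith [H.mono hx hy hxy]) (by linarith)

theorem deriv_pos (H : QCore I f g) {x d : ℝ} (hx : x ∈ I) (hd : HasDerivAt f d x) : 0 < d := by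
  obtain ⟨δ, hδ, -, h1, h2⟩ := H.exists_pm hx one_pos
  exact (H.slope_pos h1 hx (by linarith)).trans_le
    (H.fconv.slope_le_of_hasDerivAt h1 hx (by linarith) hd)

theorem near (H : QCore I f g) {m : ℝ} (hm : m ∈ I) :
    ∀ᶠ x in 𝓝 m, x ∈ I ∧ 2 * f m - f x ∈ f '' I := by
  have hc : ContinuousAt (fun x => 2 * f m - f x) m :=
    continuousAt_const.sub (H.fc.continuousAt (H.op.mem_nhds hm))
  refine (H.op.eventually_mem hm).and (hc.eventually_mem (H.jopen.mem_nhds ?_))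
  exact ⟨m, hm, by ring⟩

/-- near `m` there is a differentiability point `x` of a monotone function such that
`m` is a mean of `x` and some `y`. -/
theorem exists_good (H : QCore I f g) {k : ℝ → ℝ} (hk : MonotoneOn k I) {m : ℝ} (hm : m ∈ I) :
    ∃ x ∈ I, DifferentiableAt ℝ k x ∧ ∃ y ∈ I, f y = 2 * f m - f x := by
  obtain ⟨r, hr, hball⟩ := Metric.eventually_nhds_iff_ball.1 (H.near hm)
  obtain ⟨x, hx, hxd⟩ := aux_dense_diff hk Metric.isOpen_ball (fun y hy => (hball y hy).1)
    ⟨m, Metric.mem_ball_self hr⟩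
  exact ⟨x, (hball x hx).1, hxd, (hball x hx).2⟩

theorem mean_eq (H : QCore I f g) {x y m : ℝ} (hm : m ∈ I) (h : f y = 2 * f m - f x) :
    g ((f x + f y) / 2) = m := by
  rw [h, show (f x + (2 * f m - f x)) / 2 = f m by ring, H.inv m hm]

theorem differentiable (H : QCore I f g) {m : ℝ} (hm : m ∈ I) : DifferentiableAt ℝ f m := by
  obtain ⟨x, hx, hxd, y, hy, hxy⟩ := H.exists_good H.mono.monotoneOn hm
  have hd := hxd.hasDerivAt
  set d0 := deriv f x
  have hd0 : 0 < d0 := H.deriv_pos hx hd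
  set T := dom I x y 1 0
  set γ := cur f g x y 1 0 with hγdef
  have hT : IsOpen T := H.dom_open x y 1 0
  have h0 : (0:ℝ) ∈ T := by simp [T, dom, hx, hy]
  have hγ : ConvexOn ℝ T γ := H.cur_conv x y 1 0
  have hγ0 : γ 0 = m := by simp [hγdef, cur, H.mean_eq hm hxy]
  have hγI : ∀ t ∈ T, γ t ∈ I := fun t ht => H.gmem (H.cur_J ht)
  have hfγ : ∀ t ∈ T, f (γ t) = (f (x + t) + f y) / 2 := fun t ht => by
    have := H.fg (H.cur_J ht)
    simpa [hγdef, cur] using this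
  have hγm : StrictMonoOn γ T := by
    intro s hs t ht hst
    rw [← H.mono.lt_iff_lt (hγI s hs) (hγI t ht), hfγ s hs, hfγ t ht]
    have hs1 : x + s * 1 ∈ I := hs.1
    have ht1 : x + t * 1 ∈ I := ht.1
    rw [mul_one] at hs1 ht1
    linarith [H.mono hs1 ht1 (by linarith)]
  have hF : HasDerivAt (fun t => (f (x + t) + f y) / 2) (d0 / 2) 0 := by
    have h1 : HasDerivAt (fun t => f (x + t)) d0 0 := by
      have := HasDerivAt.comp_const_add (f := f) (f' := d0) x 0 (by simpa using hd)
      exact this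
    simpa using (h1.add_const (f y)).div_const 2
  have hmi : m ∈ interior I := by rwa [H.op.interior_eq]
  have h0i : (0:ℝ) ∈ interior T := by rwa [hT.interior_eq]
  have ha := hγ.hasDerivWithinAt_rightDeriv_of_mem_interior h0i
  have hb := hγ.hasDerivWithinAt_leftDeriv_of_mem_interior h0i
  have hab := hγ.leftDeriv_le_rightDeriv_of_mem_interior h0i
  have hc := H.fconv.hasDerivWithinAt_rightDeriv_of_mem_interior hmi
  have hd := H.fconv.hasDerivWithinAt_leftDeriv_of_mem_interior hmi
  have hcd := H.fconv.leftDeriv_le_rightDeriv_of_mem_interior hmi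
  have hdpos : 0 < derivWithin f (Iio m) m := by
    obtain ⟨δ, hδ, -, h1, h2⟩ := H.exists_pm hm one_pos
    exact (H.slope_pos h1 hm (by linarith)).trans_le
      (H.fconv.slope_le_leftDeriv_of_mem_interior h1 hmi (by linarith))
  set a := derivWithin γ (Ioi 0) 0
  set b := derivWithin γ (Iio 0) 0
  set c := derivWithin f (Ioi m) m with hcdef
  set d := derivWithin f (Iio m) m with hddef
  have e1 : c * a = d0 / 2 := by
    have hcomp : HasDerivWithinAt (f ∘ γ) (c * a) (Ioi 0 ∩ T) 0 := by
      refine HasDerivWithinAt.comp (h₂ := f) (h := γ) (s' := Ioi m) 0 (by rw [hγ0]; exact hc)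
        (ha.mono inter_subset_left) ?_
      rintro t ⟨ht, htT⟩
      have := hγm h0 htT ht
      rw [hγ0] at this
      exact this
    have hF' : HasDerivWithinAt (f ∘ γ) (d0 / 2) (Ioi 0 ∩ T) 0 :=
      hF.hasDerivWithinAt.congr (fun t ht => hfγ t ht.2) (hfγ 0 h0)
    exact ((uniqueDiffWithinAt_Ioi (0:ℝ)).inter (hT.mem_nhds h0)).eq_deriv _ hcomp hF'
  have e2 : d * b = d0 / 2 := by
    have hcomp : HasDerivWithinAt (f ∘ γ) (d * b) (Iio 0 ∩ T) 0 := by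
      refine HasDerivWithinAt.comp (h₂ := f) (h := γ) (s' := Iio m) 0 (by rw [hγ0]; exact hd)
        (hb.mono inter_subset_left) ?_
      rintro t ⟨ht, htT⟩
      have := hγm htT h0 ht
      rw [hγ0] at this
      exact this
    have hF' : HasDerivWithinAt (f ∘ γ) (d0 / 2) (Iio 0 ∩ T) 0 :=
      hF.hasDerivWithinAt.congr (fun t ht => hfγ t ht.2) (hfγ 0 h0)
    exact ((uniqueDiffWithinAt_Iio (0:ℝ)).inter (hT.mem_nhds h0)).eq_deriv _ hcomp hF'
  have hbpos : 0 < b := by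
    by_contra hneg
    push Not at hneg
    nlinarith
  have hcd' : c = d := by
    refine le_antisymm ?_ hcd
    by_contra hlt
    push Not at hlt
    nlinarith
  have hu := (hasDerivWithinAt_Ioi_iff_Ici.1 hc).union (hasDerivWithinAt_Iio_iff_Iic.1 (hcd' ▸ hd))
  rw [Ici_union_Iic] at hu
  exact (hasDerivWithinAt_univ.1 hu).differentiableAt

theorem hda (H : QCore I f g) {m : ℝ} (hm : m ∈ I) : HasDerivAt f (deriv f m) m :=
  (H.differentiable hm).hasDerivAt

theorem hpos (H : QCore I f g) {m : ℝ} (hm : m ∈ I) : 0 < deriv f m := H.deriv_pos hm (H.hda hm)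

theorem hmono (H : QCore I f g) : MonotoneOn (deriv f) I :=
  H.fconv.monotoneOn_deriv fun _ hx => H.differentiable hx

theorem hcont (H : QCore I f g) : ContinuousOn (deriv f) I :=
  aux_deriv_cont H.op H.hmono fun _ hx => H.hda hx

theorem cur_deriv (H : QCore I f g) {x y p q t : ℝ} (ht : t ∈ dom I x y p q) :
    HasDerivAt (cur f g x y p q) ((p * deriv f (x + t * p) + q * deriv f (y + t * q)) /
      (2 * deriv f (cur f g x y p q t))) t := by
  have hJ := H.cur_J ht
  have hg := HasDerivAt.of_local_left_inverse (H.gcont hJ) (H.hda (H.gmem hJ))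
    (H.hpos (H.gmem hJ)).ne' (by
      filter_upwards [H.jopen.mem_nhds hJ] with s hs using H.fg hs)
  have h1 : HasDerivAt (fun t => f (x + t * p)) (deriv f (x + t * p) * p) t := by
    have : HasDerivAt (fun t => x + t * p) p t := by
      simpa using ((hasDerivAt_id t).mul_const p).const_add x
    exact HasDerivAt.comp t (h₂ := f) (H.hda ht.1) this
  have h2 : HasDerivAt (fun t => f (y + t * q)) (deriv f (y + t * q) * q) t := by
    have : HasDerivAt (fun t => y + t * q) q t := by
      simpa using ((hasDerivAt_id t).mul_const q).const_add y
    exact HasDerivAt.comp t (h₂ := f) (H.hda ht.2) this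
  have h3 := HasDerivAt.comp t (h₂ := g) hg ((h1.add h2).div_const 2)
  refine h3.congr_deriv ?_
  have := (H.hpos (H.gmem hJ)).ne'
  unfold cur
  field_simp
  try ring

theorem key (H : QCore I f g) {x y p q c e : ℝ} (hx : x ∈ I) (hy : y ∈ I) 
    (hc : 0 ≤ c) (he : 0 ≤ e) (hN : 0 < p * deriv f x + q * deriv f y)
    (hp : 0 ≤ p) (hq : 0 ≤ q)
    (h1 : ∀ᶠ t in 𝓝[>] (0:ℝ), deriv f (x + t * p) - deriv f x ≤ c * (t * p))
    (h2 : ∀ᶠ t in 𝓝[>] (0:ℝ), deriv f (y + t * q) - deriv f y ≤ e * (t * q)) :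
    ∀ᶠ z in 𝓝[>] (g ((f x + f y) / 2)), deriv f z - deriv f (g ((f x + f y) / 2)) ≤
      (2 * (deriv f (g ((f x + f y) / 2))) ^ 2 * (p ^ 2 * c + q ^ 2 * e) /
        (p * deriv f x + q * deriv f y) ^ 2) * (z - g ((f x + f y) / 2)) := by
  set T := dom I x y p q
  set γ := cur f g x y p q with hγdef
  set m := g ((f x + f y) / 2) with hmdef
  set N := p * deriv f x + q * deriv f y with hNdef
  have hm : m ∈ I := H.gmem (H.jmid ⟨x, hx, rfl⟩ ⟨y, hy, rfl⟩)
  have hT : IsOpen T := H.dom_open x y p q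
  have h0 : (0:ℝ) ∈ T := by simp [T, dom, hx, hy]
  have hγ : ConvexOn ℝ T γ := H.cur_conv x y p q
  have hγ0 : γ 0 = m := by simp [hγdef, cur, hmdef]
  have hγI : ∀ t ∈ T, γ t ∈ I := fun t ht => H.gmem (H.cur_J ht)
  have hhm := H.hpos hm
  have hder0 : HasDerivAt γ (N / (2 * deriv f m)) 0 := by
    have := H.cur_deriv h0
    rw [← hγdef, hγ0] at this
    simpa [← hNdef] using this
  have hev : ∀ᶠ t in 𝓝[>] (0:ℝ), t ∈ T ∧
      (deriv f (x + t * p) - deriv f x ≤ c * (t * p) ∧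
       deriv f (y + t * q) - deriv f y ≤ e * (t * q)) :=
    (eventually_nhdsWithin_of_eventually_nhds (hT.eventually_mem h0)).and (h1.and h2)
  obtain ⟨t0, ht0, hsub⟩ := mem_nhdsGT_iff_exists_Ioc_subset.1 hev
  have ht0 : 0 < t0 := ht0
  have ht0T : t0 ∈ T := (hsub ⟨ht0, le_rfl⟩).1
  have hIcc : Icc 0 t0 ⊆ T := (H.dom_conv x y p q).ordConnected.out h0 ht0T
  have hs0 : 0 < N / (2 * deriv f m) := by positivity
  have htan : ∀ t ∈ Ioc 0 t0, N / (2 * deriv f m) * t ≤ γ t - m := by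
    intro t ht
    have := hγ.le_slope_of_hasDerivAt h0 (hIcc ⟨ht.1.le, ht.2⟩) ht.1 hder0
    rw [slope_def_field, hγ0, sub_zero, le_div_iff₀ ht.1] at this
    exact this
  have hmt0 : m < γ t0 := by
    have := htan t0 ⟨ht0, le_rfl⟩
    have : 0 < N / (2 * deriv f m) * t0 := by positivity
    linarith
  filter_upwards [Ioo_mem_nhdsGT hmt0] with z hz
  have hivt := intermediate_value_Icc ht0.le ((H.cur_cont x y p q).mono hIcc)
  obtain ⟨t, htI, hzt⟩ := hivt (show z ∈ Icc (γ 0) (γ t0) by rw [hγ0]; exact ⟨hz.1.le, hz.2.le⟩)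
  have hzt : γ t = z := hzt
  have htpos : 0 < t := lt_of_le_of_ne htI.1 (by
    rintro rfl
    rw [hγ0] at hzt; linarith [hz.1])
  have htm : t ∈ Ioc 0 t0 := ⟨htpos, htI.2⟩
  obtain ⟨htT, k1, k2⟩ := hsub htm
  have hmon := hγ.monotoneOn_deriv (fun s hs => (H.cur_deriv hs).differentiableAt) h0 htT htpos.le
  rw [hder0.deriv, (H.cur_deriv htT).deriv, ← hγdef, hzt] at hmon
  have hzI : z ∈ I := hzt ▸ hγI t htT
  have hhz := H.hpos hzI
  rw [div_le_div_iff₀ (by positivity) (by positivity)] at hmon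
  have htz := htan t htm
  rw [hzt] at htz
  set hm' := deriv f m
  set hz' := deriv f z
  set A := p ^ 2 * c + q ^ 2 * e with hA
  have hA0 : 0 ≤ A := by positivity
  have n1 : p * deriv f (x + t * p) + q * deriv f (y + t * q) ≤ N + A * t := by
    have := mul_le_mul_of_nonneg_left k1 hp
    have := mul_le_mul_of_nonneg_left k2 hq
    simp only [hNdef, hA]; linarith
  have n2 : N * hz' ≤ (N + A * t) * hm' := by nlinarith
  have n3 : N * (hz' - hm') ≤ A * hm' * t := by linarith
  have n4 : N * t ≤ 2 * hm' * (z - m) := by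
    rw [div_mul_eq_mul_div, div_le_iff₀ (by positivity)] at htz
    linarith
  rw [div_mul_eq_mul_div, le_div_iff₀ (by positivity)]
  have n5 := mul_le_mul_of_nonneg_left n3 hN.le
  have n6 := mul_le_mul_of_nonneg_left n4 (show 0 ≤ A * hm' by positivity)
  linarith

end QCore

namespace QCore
variable {I : Set ℝ} {f g : ℝ → ℝ}

/-- upper bounds of the right difference quotients of the derivative of f at `x` -/
def ub (f : ℝ → ℝ) (x : ℝ) : Set ℝ :=
  {c | 0 ≤ c ∧ ∀ᶠ t in 𝓝[>] x, deriv f t - deriv f x ≤ c * (t - x)}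

/-- right upper Dini derivative of the derivative of f -/
noncomputable def dn (f : ℝ → ℝ) (x : ℝ) : ℝ := sInf (ub f x)

theorem ub_bdd (f : ℝ → ℝ) (x : ℝ) : BddBelow (ub f x) := ⟨0, fun _ h => h.1⟩

theorem dn_nonneg (f : ℝ → ℝ) (x : ℝ) : 0 ≤ dn f x := Real.sInf_nonneg fun _ h => h.1

theorem ub_shift {x p c : ℝ} (hp : 0 < p) (hc : c ∈ ub f x) :
    ∀ᶠ t in 𝓝[>] (0:ℝ), deriv f (x + t * p) - deriv f x ≤ c * (t * p) := by
  have ht : Tendsto (fun t : ℝ => x + t * p) (𝓝[>] 0) (𝓝[>] x) := by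
    refine tendsto_nhdsWithin_iff.2 ⟨?_, ?_⟩
    · have : Continuous fun t : ℝ => x + t * p := by fun_prop
      have := this.tendsto 0
      simp only [zero_mul, add_zero] at this
      exact this.mono_left nhdsWithin_le_nhds
    · filter_upwards [self_mem_nhdsWithin] with t ht
      have ht : 0 < t := ht
      have : 0 < t * p := by positivity
      show x < x + t * p
      linarith
  filter_upwards [ht.eventually hc.2] with t h
  simpa using h

theorem ub_mean (H : QCore I f g) {x y c e : ℝ} (hx : x ∈ I) (hy : y ∈ I)
    (hc : c ∈ ub f x) (he : e ∈ ub f y) :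
    (deriv f (g ((f x + f y) / 2))) ^ 2 * ((c / deriv f x ^ 2 + e / deriv f y ^ 2) / 2) ∈
      ub f (g ((f x + f y) / 2)) := by
  have h1 := H.hpos hx
  have h2 := H.hpos hy
  have hc0 := hc.1
  have he0 := he.1
  refine ⟨by positivity, ?_⟩
  have hN : (deriv f x)⁻¹ * deriv f x + (deriv f y)⁻¹ * deriv f y = 2 := by
    rw [inv_mul_cancel₀ h1.ne', inv_mul_cancel₀ h2.ne']; norm_num
  have := H.key (p := (deriv f x)⁻¹) (q := (deriv f y)⁻¹) hx hy hc.1 he.1 (by rw [hN]; norm_num)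
    (by positivity) (by positivity) (ub_shift (by positivity) hc) (ub_shift (by positivity) he)
  rw [hN] at this
  filter_upwards [this] with z hz
  refine hz.trans (le_of_eq ?_)
  congr 1
  field_simp
  try ring

theorem ub_mean1 (H : QCore I f g) {x y c : ℝ} (hx : x ∈ I) (hy : y ∈ I)
    (hc : c ∈ ub f x) :
    (deriv f (g ((f x + f y) / 2))) ^ 2 * (2 * (c / deriv f x ^ 2)) ∈
      ub f (g ((f x + f y) / 2)) := by
  have h1 := H.hpos hx
  have hc0 := hc.1
  refine ⟨by positivity, ?_⟩
  have hN : (deriv f x)⁻¹ * deriv f x + 0 * deriv f y = 1 := by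
    rw [inv_mul_cancel₀ h1.ne']; norm_num
  have := H.key (p := (deriv f x)⁻¹) (q := 0) (e := 0) hx hy hc.1 le_rfl (by rw [hN]; norm_num)
    (by positivity) le_rfl (ub_shift (by positivity) hc) (by simp)
  rw [hN] at this
  filter_upwards [this] with z hz
  refine hz.trans (le_of_eq ?_)
  congr 1
  field_simp
  try ring

theorem ub_of_diff {x : ℝ} (hd : DifferentiableAt ℝ (deriv f) x) : (ub f x).Nonempty := by
  have h := hd.hasDerivAt
  rw [hasDerivAt_iff_isLittleO, Asymptotics.isLittleO_iff] at h
  have h' := h one_pos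
  refine ⟨|deriv (deriv f) x| + 1, by positivity, ?_⟩
  filter_upwards [eventually_nhdsWithin_of_eventually_nhds h', self_mem_nhdsWithin] with t ht htx
  have htx : x < t := htx
  rw [Real.norm_eq_abs, Real.norm_eq_abs, smul_eq_mul, abs_of_pos (sub_pos.2 htx)] at ht
  have h1 := (le_abs_self _).trans ht
  have h2 := mul_le_mul_of_nonneg_left (le_abs_self (deriv (deriv f) x)) (sub_pos.2 htx).le
  linarith

theorem ub_ne (H : QCore I f g) {m : ℝ} (hm : m ∈ I) : (ub f m).Nonempty := by
  obtain ⟨x, hx, hxd, y, hy, hxy⟩ := H.exists_good H.hmono hm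
  obtain ⟨c, hc⟩ := ub_of_diff hxd
  have := H.ub_mean1 hx hy hc
  rw [H.mean_eq hm hxy] at this
  exact ⟨_, this⟩

theorem ub_exists (H : QCore I f g) {m ε : ℝ} (hm : m ∈ I) (hε : 0 < ε) :
    ∃ c ∈ ub f m, c / deriv f m ^ 2 < dn f m / deriv f m ^ 2 + ε := by
  have h1 := H.hpos hm
  obtain ⟨c, hc, hlt⟩ := exists_lt_of_csInf_lt (H.ub_ne hm)
    (show sInf (ub f m) < dn f m + ε * deriv f m ^ 2 by
      have : 0 < ε * deriv f m ^ 2 := by positivity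
      unfold dn; linarith)
  refine ⟨c, hc, ?_⟩
  rw [div_add' _ _ _ (by positivity)]
  exact div_lt_div_of_pos_right hlt (by positivity)

theorem k_le (H : QCore I f g) {m c : ℝ} (hm : m ∈ I) (hc : deriv f m ^ 2 * c ∈ ub f m) :
    dn f m / deriv f m ^ 2 ≤ c := by
  have h1 := H.hpos hm
  rw [div_le_iff₀ (by positivity), mul_comm]
  exact csInf_le (ub_bdd f m) hc

theorem k_mean (H : QCore I f g) {x y : ℝ} (hx : x ∈ I) (hy : y ∈ I) :
    dn f (g ((f x + f y) / 2)) / deriv f (g ((f x + f y) / 2)) ^ 2 ≤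
      (dn f x / deriv f x ^ 2 + dn f y / deriv f y ^ 2) / 2 := by
  have hm : g ((f x + f y) / 2) ∈ I := H.gmem (H.jmid ⟨x, hx, rfl⟩ ⟨y, hy, rfl⟩)
  refine le_of_forall_pos_le_add fun ε hε => ?_
  obtain ⟨c, hc, hc'⟩ := H.ub_exists hx hε
  obtain ⟨e, he, he'⟩ := H.ub_exists hy hε
  have := H.k_le hm (H.ub_mean hx hy hc he)
  linarith

theorem k_mean1 (H : QCore I f g) {x y : ℝ} (hx : x ∈ I) (hy : y ∈ I) :
    dn f (g ((f x + f y) / 2)) / deriv f (g ((f x + f y) / 2)) ^ 2 ≤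
      2 * (dn f x / deriv f x ^ 2) := by
  have hm : g ((f x + f y) / 2) ∈ I := H.gmem (H.jmid ⟨x, hx, rfl⟩ ⟨y, hy, rfl⟩)
  refine le_of_forall_pos_le_add fun ε hε => ?_
  obtain ⟨c, hc, hc'⟩ := H.ub_exists hx (half_pos hε)
  have := H.k_le hm (H.ub_mean1 hx hy hc)
  linarith

theorem near' (H : QCore I f g) {x : ℝ} (hx : x ∈ I) :
    ∀ᶠ m in 𝓝 x, m ∈ I ∧ ∃ y ∈ I, f y = 2 * f m - f x := by
  have hc : ContinuousAt (fun m => 2 * f m - f x) x :=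
    (continuousAt_const.mul (H.fc.continuousAt (H.op.mem_nhds hx))).sub continuousAt_const
  exact (H.op.eventually_mem hx).and (hc.eventually_mem (H.jopen.mem_nhds ⟨x, hx, by ring⟩))

theorem k_cont (H : QCore I f g) : ContinuousOn (fun x => dn f x / deriv f x ^ 2) I := by
  have hφ : ContinuousOn (fun s => dn f (g s) / deriv f (g s) ^ 2) (f '' I) := by
    refine aux_midpoint_cont H.jopen ?_ ?_
    · rintro _ ⟨x, hx, rfl⟩ _ ⟨y, hy, rfl⟩
      simp only [H.inv x hx, H.inv y hy]
      exact H.k_mean hx hy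
    · rintro _ ⟨x, hx, rfl⟩
      refine ⟨2 * (dn f x / deriv f x ^ 2), ?_⟩
      have hg := H.gcont ⟨x, hx, rfl⟩
      have h1 := H.near' hx
      rw [← H.inv x hx] at h1
      filter_upwards [hg.eventually h1] with s hs
      rw [H.inv x hx] at hs
      obtain ⟨hs, y, hy, hxy⟩ := hs
      have := H.k_mean1 hx hy
      rwa [H.mean_eq hs hxy] at this
  refine (hφ.comp H.fc (mapsTo_image f I)).congr fun x hx => ?_
  simp only [Function.comp, H.inv x hx]

theorem dn_cont (H : QCore I f g) : ContinuousOn (dn f) I := by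
  refine (H.k_cont.mul (H.hcont.pow 2)).congr fun x hx => ?_
  have := H.hpos hx
  show dn f x = dn f x / deriv f x ^ 2 * deriv f x ^ 2
  field_simp

theorem hasDeriv2 (H : QCore I f g) : ∀ x ∈ I, HasDerivAt (deriv f) (dn f x) x := by
  refine aux_dini H.op H.hcont H.dn_cont ?_ ?_
  · intro x hx c hc
    obtain ⟨c', hc', hlt⟩ := exists_lt_of_csInf_lt (H.ub_ne hx) hc
    filter_upwards [hc'.2, self_mem_nhdsWithin] with t ht htx
    have htx : x < t := htx
    exact ht.trans_lt (mul_lt_mul_of_pos_right hlt (by linarith))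
  · intro x hx c hc
    by_cases h0 : 0 ≤ c
    · have hns : c ∉ ub f x := notMem_of_lt_csInf hc (ub_bdd f x)
      have : ¬ ∀ᶠ t in 𝓝[>] x, deriv f t - deriv f x ≤ c * (t - x) := fun h => hns ⟨h0, h⟩
      rw [not_eventually] at this
      exact this.mono fun t ht => not_le.1 ht
    · push Not at h0
      refine Eventually.frequently ?_
      filter_upwards [eventually_nhdsWithin_of_eventually_nhds (H.op.eventually_mem hx),
        self_mem_nhdsWithin] with t ht htx
      have htx : x < t := htx
      have := H.hmono hx ht htx.le
      nlinarith

theorem deriv2 (H : QCore I f g) {x : ℝ} (hx : x ∈ I) : deriv (deriv f) x = dn f x :=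
  (H.hasDeriv2 x hx).deriv

theorem contDiff (H : QCore I f g) : ContDiffOn ℝ 2 f I := by
  rw [show (2 : WithTop ℕ∞) = 1 + 1 by norm_num, contDiffOn_succ_iff_deriv_of_isOpen H.op]
  refine ⟨fun x hx => (H.differentiable hx).differentiableWithinAt, by simp, ?_⟩
  rw [show (1 : WithTop ℕ∞) = 0 + 1 by norm_num, contDiffOn_succ_iff_deriv_of_isOpen H.op]
  refine ⟨fun x hx => (H.hasDeriv2 x hx).differentiableAt.differentiableWithinAt, by simp, ?_⟩
  rw [contDiffOn_zero]
  exact H.dn_cont.congr fun x hx => H.deriv2 hx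

theorem affine_of_zero (H : QCore I f g) {x0 : ℝ} (hx0 : x0 ∈ I) (h0 : dn f x0 = 0) :
    ∀ x ∈ I, dn f x = 0 := by
  -- work with the open set where the second derivative vanishes
  have hop : IsOpen {x | x ∈ I ∧ dn f x = 0} := by
    rw [isOpen_iff_mem_nhds]
    rintro x ⟨hx, hx'⟩
    filter_upwards [H.near' hx] with m hm
    obtain ⟨hm, y, hy, hxy⟩ := hm
    refine ⟨hm, ?_⟩
    have := H.k_mean1 hx hy
    rw [H.mean_eq hm hxy, hx', zero_div, mul_zero] at this
    have hp := H.hpos hm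
    rw [div_le_iff₀ (by positivity), zero_mul] at this
    exact le_antisymm this (dn_nonneg f m)
  have := H.cv.isPreconnected.subset_of_closure_inter_subset hop ⟨x0, hx0, hx0, h0⟩ (by
    rintro x ⟨hxc, hx⟩
    refine ⟨hx, ?_⟩
    by_contra hne
    have hev := (H.dn_cont.continuousAt (H.op.mem_nhds hx)).eventually_ne hne
    rw [mem_closure_iff_frequently] at hxc
    obtain ⟨y, hy1, hy2⟩ := (hxc.and_eventually hev).exists
    exact hy2 hy1.2)
  exact fun x hx => (this hx).2

theorem dn_pos (H : QCore I f g) (hn : ∃ x ∈ I, ∃ y ∈ I, g ((f x + f y) / 2) ≠ (x + y) / 2) :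
    ∀ x ∈ I, 0 < dn f x := by
  intro x0 hx0
  refine lt_of_le_of_ne (dn_nonneg f x0) fun h0 => ?_
  have hz := H.affine_of_zero hx0 h0.symm
  obtain ⟨a, ha⟩ := H.op.exists_is_const_of_deriv_eq_zero H.cv.isPreconnected
    (f := deriv f) (fun x hx => (H.hasDeriv2 x hx).differentiableAt.differentiableWithinAt)
    (fun x hx => by rw [H.deriv2 hx, hz x hx]; rfl)
  have hd : ∀ x ∈ I, HasDerivAt (fun t => f t - a * t) 0 x := by
    intro x hx
    have h1 := H.hda hx
    rw [ha x hx] at h1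
    have h2 : HasDerivAt (fun t => f t - a * t) (a - a * 1) x :=
      h1.sub ((hasDerivAt_id x).const_mul a)
    simpa using h2
  obtain ⟨b, hb⟩ := H.op.exists_is_const_of_deriv_eq_zero H.cv.isPreconnected
    (f := fun t => f t - a * t) (fun x hx => (hd x hx).differentiableAt.differentiableWithinAt)
    (fun x hx => (hd x hx).deriv)
  obtain ⟨x, hx, y, hy, hne⟩ := hn
  apply hne
  have hm : (x + y) / 2 ∈ I := by
    have := H.cv hx hy (a := 1/2) (b := 1/2) (by norm_num) (by norm_num) (by norm_num)
    convert this using 1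
    simp; ring
  have e1 := hb x hx
  have e2 := hb y hy
  have e3 := hb _ hm
  rw [show (f x + f y) / 2 = f ((x + y) / 2) by linarith, H.inv _ hm]

end QCore

theorem stmt_19 (I : Set ℝ) (hIop : IsOpen I) (hIcv : Convex ℝ I) (hIne : I.Nonempty)
    (f : ℝ → ℝ) (hfc : ContinuousOn f I)
    (hfm : StrictMonoOn f I ∨ StrictAntiOn f I)
    (hconv : ∀ x ∈ I, ∀ y ∈ I, ∀ u ∈ I, ∀ v ∈ I,
      QAMean I f ![(x + y) / 2, (u + v) / 2] ≤
        (QAMean I f ![x, u] + QAMean I f ![y, v]) / 2)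
    (hnotA : ∃ x ∈ I, ∃ y ∈ I, QAMean I f ![x, y] ≠ (x + y) / 2) :
    ContDiffOn ℝ 2 f I ∧ (∀ x ∈ I, deriv f x ≠ 0) ∧
    (∀ x ∈ I, deriv (deriv f) x ≠ 0) ∧
    (∃ x ∈ I, ∃ y ∈ I, (x + y) / 2 < QAMean I f ![x, y]) ∧
    ((∀ x ∈ I, 0 < deriv (deriv f) x / deriv f x) ∨
      (∀ x ∈ I, 0 < deriv (deriv (fun t => -f t)) x / deriv (fun t => -f t) x)) := by
  have hQ : ∀ x y : ℝ, QAMean I f ![x, y] = Function.invFunOn f I ((f x + f y) / 2) := by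
    intro x y
    simp [QAMean, Fin.sum_univ_two]
  simp only [hQ] at hconv hnotA ⊢
  rcases hfm with hm | hm
  · have H : QCore I f (Function.invFunOn f I) :=
      ⟨hIop, hIcv, hfc, hm, fun x hx => hm.injOn.leftInvOn_invFunOn hx, hconv⟩
    have h2 := H.dn_pos hnotA
    refine ⟨H.contDiff, fun x hx => (H.hpos hx).ne', fun x hx => ?_, ?_, Or.inl fun x hx => ?_⟩
    · rw [H.deriv2 hx]; exact (h2 x hx).ne'
    · obtain ⟨x, hx, y, hy, hne⟩ := hnotA
      exact ⟨x, hx, y, hy, lt_of_le_of_ne (H.mid_le hx hy) hne.symm⟩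
    · rw [H.deriv2 hx]; exact div_pos (h2 x hx) (H.hpos hx)
  · have hav : ∀ a b : ℝ, -((-a + -b) / 2) = (a + b) / 2 := fun a b => by ring
    have H : QCore I (fun t => - f t) (fun s => Function.invFunOn f I (-s)) := by
      refine ⟨hIop, hIcv, hfc.neg, hm.neg, fun x hx => ?_, ?_⟩
      · simpa using hm.injOn.leftInvOn_invFunOn hx
      · simpa only [hav] using hconv
    have hnotA' : ∃ x ∈ I, ∃ y ∈ I,
        (fun s => Function.invFunOn f I (-s)) ((-f x + -f y) / 2) ≠ (x + y) / 2 := by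
      simpa only [hav] using hnotA
    have h2 := H.dn_pos hnotA'
    have hd1 : deriv (fun t => - f t) = fun t => - deriv f t := by
      funext t; exact deriv.fun_neg
    have hd2 : ∀ x, deriv (deriv (fun t => - f t)) x = - deriv (deriv f) x := by
      intro x; rw [hd1]; exact deriv.fun_neg
    refine ⟨?_, fun x hx => ?_, fun x hx => ?_, ?_, Or.inr fun x hx => ?_⟩
    · simpa using H.contDiff.neg
    · have := H.hpos hx
      rw [hd1] at this
      intro h0; simp [h0] at this
    · have := h2 x hx
      rw [← H.deriv2 hx, hd2] at this
      intro h0; simp [h0] at this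
    · obtain ⟨x, hx, y, hy, hne⟩ := hnotA
      have := H.mid_le hx hy
      simp only [hav] at this
      exact ⟨x, hx, y, hy, lt_of_le_of_ne this hne.symm⟩
    · rw [H.deriv2 hx]; exact div_pos (h2 x hx) (H.hpos hx)
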